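/- arXiv:1903.04964 — 2 statements merged into one kernel-verified Lean document; each statement's English description precedes it below -/
import Mathlib

section
/- For every bounded, open, convex set K ⊆ ℝⁿ with n ≥ 2, there is a dimensional constant C(n) > 0 such that diam(K) ≤ C(n) · P(K)^{n-1} / V(K)^{n-2}. -/
open MeasureTheory Metric

/-- The perimeter `P(E) = μH^{n-1}(∂E)`, as a real number. -/
noncomputable def perimR (n : ℕ) (E : Set (EuclideanSpace ℝ (Fin n))) : ℝ :=
  (μH[(n : ℝ) - 1] (frontier E)).toReal

/-- The volume (Lebesgue measure), as a real number. -/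
noncomputable def volR (n : ℕ) (E : Set (EuclideanSpace ℝ (Fin n))) : ℝ :=
  (volume E).toReal

open scoped Pointwise

open InnerProductSpace in
lemma greedy (n : ℕ) (S : Set (EuclideanSpace ℝ (Fin n))) (hb : Bornology.IsBounded S)
    (h0 : S ∈ nhds 0) :
    ∃ (d : Fin n → EuclideanSpace ℝ (Fin n)) (e : OrthonormalBasis (Fin n) ℝ (EuclideanSpace ℝ (Fin n))),
      (∀ i, d i ∈ S) ∧ (∀ i, 0 < inner ℝ (e i) (d i)) ∧
      (∀ i, ∀ z ∈ S, |inner ℝ (e i) z| ≤ 2 * inner ℝ (e i) (d i)) ∧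
      e.toBasis.det d = ∏ i, inner ℝ (e i) (d i) ∧
      (∀ i : Fin n, i.val = 0 → ∀ z ∈ S, ‖z‖ ≤ 2 * inner ℝ (e i) (d i)) := by
  classical
  have key : ∀ W : Submodule ℝ (EuclideanSpace ℝ (Fin n)), ∃ d ∈ S, ∀ z ∈ S,
      ‖Wᗮ.starProjection z‖ ≤ 2 * ‖Wᗮ.starProjection d‖ := by
    intro W
    by_contra! hcon
    obtain ⟨R, hR⟩ := hb.exists_norm_le
    have hz0 : (0 : EuclideanSpace ℝ (Fin n)) ∈ S := mem_of_mem_nhds h0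
    set s := (fun z => ‖Wᗮ.starProjection z‖) '' S with hs
    have hbdd : BddAbove s := by
      refine ⟨R, ?_⟩
      rintro _ ⟨z, hz, rfl⟩
      exact (Submodule.norm_starProjection_apply_le _ z).trans (hR z hz)
    have hne : s.Nonempty := ⟨_, 0, hz0, rfl⟩
    obtain ⟨z1, hz1, h1⟩ := hcon 0 hz0
    have hp : 0 < sSup s := by
      refine lt_of_lt_of_le ?_ (le_csSup hbdd ⟨z1, hz1, rfl⟩)
      simpa using h1
    obtain ⟨_, ⟨d, hd, rfl⟩, hlt⟩ := exists_lt_of_lt_csSup hne (half_lt_self hp)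
    obtain ⟨z, hz, h⟩ := hcon d hd
    have := le_csSup hbdd ⟨z, hz, rfl⟩
    simp only at this hlt
    linarith
  choose f hfS hf using key
  obtain ⟨W, hW0, hWs⟩ : ∃ W : ℕ → Submodule ℝ (EuclideanSpace ℝ (Fin n)), W 0 = ⊥ ∧
      ∀ k, W (k+1) = W k ⊔ Submodule.span ℝ {f (W k)} :=
    ⟨fun k => Nat.rec ⊥ (fun _ U => U ⊔ Submodule.span ℝ {f U}) k, rfl, fun k => rfl⟩
  let d : Fin n → EuclideanSpace ℝ (Fin n) := fun i => f (W i)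
  have hWspan : ∀ k : ℕ, k ≤ n → W k = Submodule.span ℝ (d '' {i | i.val < k}) := by
    intro k
    induction k with
    | zero => intro _; simp [hW0]
    | succ k ih =>
      intro hk
      rw [hWs, ih (by omega), ← Submodule.span_union]
      congr 1
      ext x
      constructor
      · rintro (⟨i, hi, rfl⟩ | hx)
        · exact ⟨i, Nat.lt_succ_of_lt hi, rfl⟩
        · refine ⟨⟨k, by omega⟩, by simp, ?_⟩
          rw [Set.mem_singleton_iff] at hx
          rw [hx, ← ih (by omega)]
      · rintro ⟨i, hi, rfl⟩
        rcases Nat.lt_succ_iff_lt_or_eq.1 hi with h | h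
        · exact Or.inl ⟨i, h, rfl⟩
        · right
          rw [Set.mem_singleton_iff, ← ih (by omega), ← h]
  have hWi : ∀ i : Fin n, W i = Submodule.span ℝ (d '' Set.Iio i) := by
    intro i; rw [hWspan i i.2.le]; rfl
  have hgs : ∀ i : Fin n, gramSchmidt ℝ d i = (W i.val)ᗮ.starProjection (d i) := by
    intro i
    symm
    refine Submodule.eq_starProjection_of_mem_orthogonal ?_ ?_
    · rw [hWi, ← span_gramSchmidt_Iio ℝ, Submodule.mem_orthogonal]
      intro u hu
      induction hu using Submodule.span_induction with
      | mem x hx =>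
        obtain ⟨j, hj, rfl⟩ := hx
        exact gramSchmidt_orthogonal ℝ d (ne_of_lt hj)
      | zero => simp
      | add x y _ _ hx hy => rw [inner_add_left, hx, hy, add_zero]
      | smul a x _ hx => rw [inner_smul_left, hx, mul_zero]
    · rw [Submodule.orthogonal_orthogonal, hWi, ← span_gramSchmidt_Iio ℝ]
      rw [gramSchmidt_def ℝ d i, sub_sub_cancel]
      refine Submodule.sum_mem _ fun j hj => ?_
      rw [Submodule.starProjection_singleton]
      exact Submodule.smul_mem _ _ (Submodule.subset_span ⟨j, by simpa using hj, rfl⟩)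
  have hne : ∀ i : Fin n, gramSchmidt ℝ d i ≠ 0 := by
    intro i h
    rw [hgs] at h
    have hlt : W i < ⊤ := by
      rw [hWi]
      refine Submodule.lt_top_of_finrank_lt_finrank ?_
      have := finrank_span_finset_le_card (R := ℝ) ((Finset.Iio i).image d)
      have h2 : ((Finset.Iio i).image d).card ≤ i := Finset.card_image_le.trans (by simp)
      rw [Finset.coe_image, Finset.coe_Iio] at this
      have h3 := i.2
      rw [finrank_euclideanSpace_fin]
      exact lt_of_le_of_lt (this.trans h2) h3
    have hbot : (W i.val)ᗮ ≠ ⊥ := by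
      rw [Ne, Submodule.orthogonal_eq_bot_iff]; exact hlt.ne
    obtain ⟨v, hv, hv0⟩ := Submodule.exists_mem_ne_zero_of_ne_bot hbot
    have : Filter.Tendsto (fun t : ℝ => t • v) (nhdsWithin 0 {0}ᶜ) (nhds 0) := by
      have : Continuous (fun t : ℝ => t • v) := by fun_prop
      simpa using (this.tendsto 0).mono_left nhdsWithin_le_nhds
    obtain ⟨t, ht, ht0⟩ := ((this.eventually h0).and self_mem_nhdsWithin).exists
    have := hf (W i) _ ht
    rw [show f (W i) = d i from rfl, h, Submodule.starProjection_eq_self_iff.2 (Submodule.smul_mem _ _ hv)] at this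
    simp [norm_le_zero_iff, hv0] at this
    exact ht0 this
  have hcard : Module.finrank ℝ (EuclideanSpace ℝ (Fin n)) = Fintype.card (Fin n) := by simp
  set e := gramSchmidtOrthonormalBasis hcard d with he
  have hei : ∀ i, e i = ‖gramSchmidt ℝ d i‖⁻¹ • gramSchmidt ℝ d i := by
    intro i
    have : gramSchmidtNormed ℝ d i = ‖gramSchmidt ℝ d i‖⁻¹ • gramSchmidt ℝ d i := rfl
    rw [he, gramSchmidtOrthonormalBasis_apply, this]
    rw [this]
    simp [hne i]
  have heW : ∀ i : Fin n, e i ∈ (W i.val)ᗮ := by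
    intro i
    rw [hei, hgs]
    exact Submodule.smul_mem _ _ (Submodule.starProjection_apply_mem _ _)
  have hproj : ∀ (i : Fin n) z, inner ℝ (e i) z = inner ℝ (e i) ((W i.val)ᗮ.starProjection z) := by
    intro i z
    rw [← Submodule.inner_starProjection_left_eq_right, Submodule.starProjection_eq_self_iff.2 (heW i)]
  have hin : ∀ i, inner ℝ (e i) (d i) = ‖gramSchmidt ℝ d i‖ := by
    intro i
    rw [hproj, ← hgs, hei, inner_smul_left, real_inner_self_eq_norm_sq]
    have := norm_ne_zero_iff.2 (hne i)
    simp
    field_simp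
  refine ⟨d, e, fun i => hfS _, fun i => ?_, fun i z hz => ?_, gramSchmidtOrthonormalBasis_det _ _, ?_⟩
  · rw [hin]; exact norm_pos_iff.2 (hne i)
  · rw [hin, hproj, hgs]
    refine (abs_real_inner_le_norm _ _).trans ?_
    rw [e.norm_eq_one, one_mul]
    exact hf (W i) z hz
  · intro i hi z hz
    have := hf (W i) z hz
    rw [hin, hgs]
    have h0 : (W i.val)ᗮ = ⊤ := by rw [hi, hW0]; simp
    have h1 : (W i.val)ᗮ.starProjection z = z := Submodule.starProjection_eq_self_iff.2 (by rw [h0]; trivial)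
    rw [h1] at this
    exact this


lemma radial_lip {E : Type*} [NormedAddCommGroup E] [NormedSpace ℝ E] (g : E → ℝ) (L : NNReal)
    (hg : LipschitzWith L g) (c M : ℝ) (hc : 0 < c) (hM : 0 ≤ M) (s : Set E)
    (hs : ∀ x ∈ s, ‖x‖ ≤ M ∧ c ≤ g x) :
    ∃ C : NNReal, LipschitzOnWith C (fun x => (g x)⁻¹ • x) s := by
  refine ⟨(c⁻¹ + M * L * c⁻¹ * c⁻¹).toNNReal, LipschitzOnWith.of_dist_le_mul ?_⟩
  intro x hx y hy
  rw [Real.coe_toNNReal _ (by positivity)]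
  obtain ⟨hxM, hxc⟩ := hs x hx
  obtain ⟨hyM, hyc⟩ := hs y hy
  have hgx : 0 < g x := hc.trans_le hxc
  have hgy : 0 < g y := hc.trans_le hyc
  have h1 : (g x)⁻¹ ≤ c⁻¹ := inv_anti₀ hc hxc
  have h2 : (g y)⁻¹ ≤ c⁻¹ := inv_anti₀ hc hyc
  have e : (g x)⁻¹ • x - (g y)⁻¹ • y = (g x)⁻¹ • (x - y) + ((g y - g x) * (g x)⁻¹ * (g y)⁻¹) • y := by
    rw [smul_sub, sub_add, ← sub_smul]
    congr 2
    field_simp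
    ring
  rw [dist_eq_norm, e]
  refine (norm_add_le _ _).trans ?_
  rw [norm_smul, norm_smul, norm_mul, norm_mul, norm_inv, norm_inv, Real.norm_of_nonneg hgx.le,
    Real.norm_of_nonneg hgy.le, ← dist_eq_norm, ← dist_eq_norm]
  have h3 : dist (g y) (g x) ≤ L * dist x y := by
    rw [dist_comm x y]; exact hg.dist_le_mul y x
  have : dist (g y) (g x) * (g x)⁻¹ * (g y)⁻¹ * ‖y‖ ≤ (L * dist x y) * c⁻¹ * c⁻¹ * M := by
    gcongr
  have h4 : (g x)⁻¹ * dist x y ≤ c⁻¹ * dist x y := by gcongr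
  linarith

lemma face_lip (m : ℕ) (i : Fin (m+1)) (s : ℝ) :
    ∃ C : NNReal, LipschitzWith C
      (fun y : Fin m → ℝ => WithLp.toLp 2 (i.insertNth s y : Fin (m+1) → ℝ)) := by
  have h1 : LipschitzWith 1 (fun y : Fin m → ℝ => (i.insertNth s y : Fin (m+1) → ℝ)) := by
    refine LipschitzWith.of_dist_le_mul fun x y => ?_
    rw [NNReal.coe_one, one_mul, dist_pi_le_iff dist_nonneg]
    intro j
    refine Fin.succAboveCases i ?_ (fun k => ?_) j
    · simp
    · simpa using dist_le_pi_dist x y k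
  exact ⟨_, (PiLp.lipschitzWith_toLp 2 (fun _ : Fin (m+1) => ℝ)).comp h1⟩

lemma frontier_fin0 (m : ℕ) (K : Set (EuclideanSpace ℝ (Fin (m+1)))) (hb : Bornology.IsBounded K)
    (h0 : K ∈ nhds 0) (hc : Convex ℝ K) : μH[(m : ℝ)] (frontier K) < ⊤ := by
  obtain ⟨L, hL⟩ := hc.lipschitz_gauge h0
  obtain ⟨R, hR0, hR⟩ := hb.exists_pos_norm_le
  have hgl : ∀ x, ‖x‖ / R ≤ gauge K x := by
    intro x
    exact le_gauge_of_subset_closedBall (absorbent_nhds_zero h0) hR0.le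
      (fun z hz => by simpa using hR z hz)
  let cube : Set (Fin m → ℝ) := Set.Icc (fun _ => -1) (fun _ => 1)
  let F : Fin (m+1) × Bool → (Fin m → ℝ) → EuclideanSpace ℝ (Fin (m+1)) := fun p y =>
    WithLp.toLp 2 (p.1.insertNth (if p.2 then (1:ℝ) else -1) y : Fin (m+1) → ℝ)
  let h : EuclideanSpace ℝ (Fin (m+1)) → EuclideanSpace ℝ (Fin (m+1)) := fun x => (gauge K x)⁻¹ • x
  have hsub : frontier K ⊆ ⋃ p, h '' (F p '' cube) := by
    intro x hx
    have hx1 := (gauge_eq_one_iff_mem_frontier hc h0).2 hx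
    obtain ⟨i, -, hi⟩ := Finset.exists_max_image Finset.univ (fun i => |x i|) ⟨0, Finset.mem_univ _⟩
    have hxi : 0 < |x i| := by
      by_contra hcon
      have : x = 0 := by
        ext j
        have := hi j (Finset.mem_univ _)
        have h2 := abs_nonneg (x j)
        exact abs_eq_zero.1 (by linarith)
      rw [this, gauge_zero] at hx1
      exact zero_ne_one hx1
    have hne : x i ≠ 0 := abs_pos.1 hxi
    refine Set.mem_iUnion.2 ⟨(i, decide (0 < x i)), |x i|⁻¹ • x,
      ⟨fun j => |x i|⁻¹ * x (i.succAbove j), ?_, ?_⟩, ?_⟩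
    · have : ∀ j, |(|x i|⁻¹ * x (i.succAbove j))| ≤ 1 := by
        intro j
        rw [abs_mul, abs_inv, abs_abs, inv_mul_le_iff₀ hxi, mul_one]
        exact hi _ (Finset.mem_univ _)
      exact ⟨fun j => (abs_le.1 (this j)).1, fun j => (abs_le.1 (this j)).2⟩
    · ext j
      refine Fin.succAboveCases i ?_ (fun k => ?_) j
      · simp only [F, Fin.insertNth_apply_same, PiLp.smul_apply, smul_eq_mul, decide_eq_true_eq]
        split_ifs with hp
        · rw [abs_of_pos hp, inv_mul_cancel₀ hne]
        · rw [abs_of_nonpos (not_lt.1 hp)]; field_simp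
      · simp [F]
    · simp only [h]
      rw [gauge_smul_of_nonneg (by positivity), hx1, smul_smul]
      simp [hxi.ne']
  refine lt_of_le_of_lt (measure_mono hsub) ?_
  refine lt_of_le_of_lt (measure_iUnion_fintype_le _ _) ?_
  refine ENNReal.sum_lt_top.2 fun p _ => ?_
  have hcube : μH[(m : ℝ)] cube < ⊤ := by
    have := hausdorffMeasure_pi_real (ι := Fin m)
    rw [Fintype.card_fin] at this
    rw [this]
    exact isCompact_Icc.measure_lt_top
  obtain ⟨C1, hC1⟩ := face_lip m p.1 (if p.2 then (1:ℝ) else -1)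
  have hFc : μH[(m : ℝ)] (F p '' cube) < ⊤ := by
    refine lt_of_le_of_lt (hC1.lipschitzOnWith.hausdorffMeasure_image_le (Nat.cast_nonneg m)) ?_
    exact ENNReal.mul_lt_top (by finiteness) hcube
  obtain ⟨M, hM0, hM⟩ : ∃ M : ℝ, 0 < M ∧ ∀ x ∈ F p '' cube, ‖x‖ ≤ M :=
    ((isCompact_Icc : IsCompact cube).image hC1.continuous).isBounded.exists_pos_norm_le
  obtain ⟨C2, hC2⟩ := radial_lip (gauge K) L hL (1 / R) M (by positivity) hM0.le (F p '' cube) (by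
    rintro x hx
    refine ⟨hM x hx, le_trans ?_ (hgl x)⟩
    gcongr
    obtain ⟨y, hy, rfl⟩ := hx
    refine le_trans ?_ (PiLp.norm_apply_le (F p y) p.1)
    simp only [F, Fin.insertNth_apply_same]
    split_ifs <;> simp)
  refine lt_of_le_of_lt (hC2.hausdorffMeasure_image_le (Nat.cast_nonneg m)) ?_
  exact ENNReal.mul_lt_top (by finiteness) hFc

lemma frontier_fin (m : ℕ) (K : Set (EuclideanSpace ℝ (Fin (m+1)))) (hb : Bornology.IsBounded K)
    (ho : IsOpen K) (hne : K.Nonempty) (hc : Convex ℝ K) : μH[(m : ℝ)] (frontier K) < ⊤ := by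
  obtain ⟨x0, hx0⟩ := hne
  let T : EuclideanSpace ℝ (Fin (m+1)) ≃ᵢ EuclideanSpace ℝ (Fin (m+1)) := IsometryEquiv.addRight x0
  have := frontier_fin0 m (T ⁻¹' K) (T.isometry.antilipschitz.isBounded_preimage hb)
    ((ho.preimage T.continuous).mem_nhds (by simpa [T] using hx0))
    (hc.translate_preimage_left x0)
  have e : frontier (T ⁻¹' K) = T ⁻¹' frontier K := (T.toHomeomorph.preimage_frontier K).symm
  rw [e, IsometryEquiv.hausdorffMeasure_preimage] at this
  exact this


lemma frontier_hit {E : Type*} [NormedAddCommGroup E] [NormedSpace ℝ E] (K : Set E)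
    (hb : Bornology.IsBounded K) (x v : E) (hx : x ∈ K) (hv : v ≠ 0) :
    ∃ t : ℝ, x + t • v ∈ frontier K := by
  have hcont : Continuous (fun t : ℝ => x + t • v) := by fun_prop
  have hne : (frontier ((fun t : ℝ => x + t • v) ⁻¹' K)).Nonempty := by
    rw [nonempty_frontier_iff]
    refine ⟨⟨0, by simpa using hx⟩, fun h => ?_⟩
    obtain ⟨R, hR0, hR⟩ := hb.exists_pos_norm_le
    have hv' : 0 < ‖v‖ := norm_pos_iff.2 hv
    have h1 : x + ((R + ‖x‖ + 1) / ‖v‖) • v ∈ K := by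
      have : ((R + ‖x‖ + 1) / ‖v‖) ∈ (fun t : ℝ => x + t • v) ⁻¹' K := h ▸ Set.mem_univ _
      exact this
    have h2 := hR _ h1
    have h3 : ‖((R + ‖x‖ + 1) / ‖v‖) • v‖ = R + ‖x‖ + 1 := by
      rw [norm_smul, Real.norm_of_nonneg (by positivity)]
      field_simp
    have h4 := norm_sub_le (x + ((R + ‖x‖ + 1) / ‖v‖) • v) x
    rw [add_sub_cancel_left, h3] at h4
    linarith
  obtain ⟨t, ht⟩ := hne
  exact ⟨t, hcont.frontier_preimage_subset K ht⟩

lemma slab (m : ℕ) (K : Set (EuclideanSpace ℝ (Fin (m+1)))) (hb : Bornology.IsBounded K)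
    (e : OrthonormalBasis (Fin (m+1)) ℝ (EuclideanSpace ℝ (Fin (m+1)))) (i : Fin (m+1)) (a : ℝ)
    (ha : ∀ x ∈ K, ∀ y ∈ K, |inner ℝ (e i) (x - y)| ≤ a) :
    volume K ≤ ENNReal.ofReal (2 * a) * μH[(m : ℝ)] (frontier K) := by
  rcases K.eq_empty_or_nonempty with rfl | ⟨x0, hx0⟩
  · simp
  let φ : EuclideanSpace ℝ (Fin (m+1)) → (Fin m → ℝ) := fun x j => e.repr x (i.succAbove j)
  have hφ : LipschitzWith 1 φ := by
    refine LipschitzWith.of_dist_le_mul fun x y => ?_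
    rw [NNReal.coe_one, one_mul, dist_pi_le_iff dist_nonneg]
    intro j
    rw [← e.repr.dist_map x y, dist_eq_norm, dist_eq_norm]
    exact PiLp.norm_apply_le (e.repr x - e.repr y) _
  have hsub : φ '' K ⊆ φ '' frontier K := by
    rintro _ ⟨x, hx, rfl⟩
    obtain ⟨t, ht⟩ := frontier_hit K hb x (e i) hx (e.orthonormal.ne_zero i)
    refine ⟨_, ht, ?_⟩
    ext j
    simp [φ, Fin.succAbove_ne]
  have h1 : volume (φ '' K) ≤ μH[(m : ℝ)] (frontier K) := by
    refine (measure_mono hsub).trans ?_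
    have := hausdorffMeasure_pi_real (ι := Fin m)
    rw [Fintype.card_fin] at this
    rw [← this]
    simpa using hφ.hausdorffMeasure_image_le (Nat.cast_nonneg m) (frontier K)
  let Ψ : EuclideanSpace ℝ (Fin (m+1)) → ℝ × (Fin m → ℝ) := fun x =>
    MeasurableEquiv.piFinSuccAbove (fun _ => ℝ) i (WithLp.ofLp (e.repr x))
  have hΨ : MeasurePreserving Ψ volume volume :=
    (volume_preserving_piFinSuccAbove (fun _ => ℝ) i).comp
      ((PiLp.volume_preserving_ofLp (Fin (m+1))).comp e.measurePreserving_repr)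
  set c := inner ℝ (e i) x0
  have hK : K ⊆ Ψ ⁻¹' (Set.Icc (c - a) (c + a) ×ˢ toMeasurable volume (φ '' K)) := by
    intro x hx
    refine ⟨?_, subset_toMeasurable _ _ ⟨x, hx, ?_⟩⟩
    · have := ha x hx x0 hx0
      rw [inner_sub_right, abs_le] at this
      have h2 : (Ψ x).1 = inner ℝ (e i) x := by
        exact e.repr_apply_apply x i
      rw [h2]
      constructor <;> simp only [c] <;> linarith [this.1, this.2]
    · rfl
  refine (measure_mono hK).trans ?_
  rw [hΨ.measure_preimage (measurableSet_Icc.prod (measurableSet_toMeasurable _ _)).nullMeasurableSet,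
    Measure.volume_eq_prod, Measure.prod_prod, measure_toMeasurable, Real.volume_Icc]
  gcongr
  linarith

lemma lower (n : ℕ) (hn : 0 < n) (K : Set (EuclideanSpace ℝ (Fin n))) (hc : Convex ℝ K)
    (d : Fin n → EuclideanSpace ℝ (Fin n)) (e : OrthonormalBasis (Fin n) ℝ (EuclideanSpace ℝ (Fin n)))
    (hd : ∀ i, ∃ x ∈ K, ∃ y ∈ K, x - y = d i) :
    ENNReal.ofReal (((n : ℝ)⁻¹) ^ n * |e.toBasis.det d|) ≤ volume K := by
  choose x hx y hy hxy using hd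
  have hn' : (0 : ℝ) < n := by exact_mod_cast hn
  set c : EuclideanSpace ℝ (Fin n) := ∑ i, (n : ℝ)⁻¹ • y i
  have hsub : parallelepiped (fun i => (n : ℝ)⁻¹ • d i) ⊆ (fun z => c + z) ⁻¹' K := by
    rintro z hz
    rw [mem_parallelepiped_iff] at hz
    obtain ⟨t, ht, rfl⟩ := hz
    have e1 : c + ∑ i, t i • (n : ℝ)⁻¹ • d i = ∑ i, (n : ℝ)⁻¹ • ((1 - t i) • y i + t i • x i) := by
      rw [← Finset.sum_add_distrib]
      refine Finset.sum_congr rfl fun i _ => ?_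
      rw [← hxy]
      module
    show c + _ ∈ K
    rw [e1]
    refine hc.sum_mem (fun i _ => by positivity) ?_ fun i _ => ?_
    · simp [hn'.ne']
    · exact hc (hy i) (hx i) (sub_nonneg.2 (ht.2 i)) (ht.1 i) (by ring)
  have h := measure_mono (μ := volume) hsub
  rw [measure_preimage_add, ← e.addHaar_eq_volume, Measure.addHaar_parallelepiped] at h
  rw [← e.addHaar_eq_volume]
  refine le_trans (le_of_eq ?_) h
  congr 1
  have := e.toBasis.det.map_smul_univ (fun _ => (n : ℝ)⁻¹) d
  rw [this]
  simp [abs_mul]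


/-- For every bounded open convex `K ⊆ ℝⁿ`, `diam K ≤ C(n) P(K)^{n-1} / V(K)^{n-2}`. -/
theorem stmt2 (n : ℕ) (hn : 2 ≤ n) :
    ∃ C : ℝ, 0 < C ∧ ∀ K : Set (EuclideanSpace ℝ (Fin n)),
      Bornology.IsBounded K → IsOpen K → Convex ℝ K →
      diam K ≤ C * perimR n K ^ (n - 1) / volR n K ^ (n - 2) := by
  obtain ⟨k, rfl⟩ : ∃ k, n = k + 2 := ⟨n - 2, by omega⟩
  refine ⟨2 * 4 ^ (k + 1) * ((k + 2 : ℕ) : ℝ) ^ (k + 2), by positivity, ?_⟩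
  intro K hb ho hc
  rcases K.eq_empty_or_nonempty with rfl | hne
  · simp only [diam_empty]
    unfold perimR volR
    positivity
  obtain ⟨x0, hx0⟩ := hne
  have hPfin : μH[((k + 1 : ℕ) : ℝ)] (frontier K) < ⊤ := frontier_fin (k + 1) K hb ho ⟨x0, hx0⟩ hc
  have hP : perimR (k + 2) K = (μH[((k + 1 : ℕ) : ℝ)] (frontier K)).toReal := by
    unfold perimR
    congr 3
    push_cast
    ring
  have hVfin : volume K < ⊤ := hb.measure_lt_top
  have hVpos : 0 < volR (k + 2) K :=
    ENNReal.toReal_pos (ho.measure_pos volume ⟨x0, hx0⟩).ne' hVfin.ne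
  set P := perimR (k + 2) K with hPdef
  set V := volR (k + 2) K with hVdef
  have hP0 : 0 ≤ P := ENNReal.toReal_nonneg
  -- difference body
  have hS0 : K - K ∈ nhds (0 : EuclideanSpace ℝ (Fin (k + 2))) := by
    refine (ho.sub_right (t := K)).mem_nhds ?_
    exact ⟨x0, hx0, x0, hx0, sub_self x0⟩
  obtain ⟨d, e, hd, hpos, hw, hdet, hdiam⟩ := greedy (k + 2) (K - K) (hb.sub hb) hS0
  have hlow := lower (k + 2) (by omega) K hc d e (fun i => by
    obtain ⟨x, hx, y, hy, h⟩ := hd i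
    exact ⟨x, hx, y, hy, h⟩)
  set a : Fin (k + 2) → ℝ := fun i => inner ℝ (e i) (d i) with ha
  have hlow' : (((k + 2 : ℕ) : ℝ)⁻¹) ^ (k + 2) * ∏ i, a i ≤ V := by
    rw [hdet, abs_of_pos (Finset.prod_pos fun i _ => hpos i)] at hlow
    exact (ENNReal.ofReal_le_iff_le_toReal hVfin.ne).1 hlow
  have hslab : ∀ i, V ≤ 4 * a i * P := by
    intro i
    have h := slab (k + 1) K hb e i (2 * a i) (fun x hx y hy => hw i _ (Set.sub_mem_sub hx hy))
    have h2 := ENNReal.toReal_mono (ENNReal.mul_ne_top ENNReal.ofReal_ne_top hPfin.ne) h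
    rw [ENNReal.toReal_mul, ENNReal.toReal_ofReal (by have := hpos i; positivity), ← hP] at h2
    calc V ≤ _ := h2
      _ = _ := by ring
  have hD : diam K ≤ 2 * a 0 := by
    refine diam_le_of_forall_dist_le (by have := hpos 0; positivity) fun x hx y hy => ?_
    rw [dist_eq_norm]
    exact hdiam 0 rfl _ (Set.sub_mem_sub hx hy)
  have hprod : V ^ (k + 1) ≤ 4 ^ (k + 1) * P ^ (k + 1) * ∏ i : Fin (k + 1), a i.succ := by
    have : ∏ _i : Fin (k + 1), V ≤ ∏ i : Fin (k + 1), (4 * P * a i.succ) :=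
      Finset.prod_le_prod (fun _ _ => hVpos.le) fun i _ => by linarith [hslab i.succ]
    rw [Finset.prod_mul_distrib] at this
    simpa [mul_pow] using this
  have hN : (0 : ℝ) < ((k + 2 : ℕ) : ℝ) ^ (k + 2) := by positivity
  have hall : a 0 * ∏ i : Fin (k + 1), a i.succ ≤ ((k + 2 : ℕ) : ℝ) ^ (k + 2) * V := by
    rw [Fin.prod_univ_succ, inv_pow, inv_mul_le_iff₀ hN] at hlow'
    exact hlow'
  rw [show k + 2 - 1 = k + 1 from rfl, show k + 2 - 2 = k from rfl, le_div_iff₀ (by positivity)]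
  refine le_of_mul_le_mul_right ?_ hVpos
  have ha0 : 0 < a 0 := hpos 0
  calc diam K * V ^ k * V = diam K * V ^ (k + 1) := by ring
    _ ≤ 2 * a 0 * (4 ^ (k + 1) * P ^ (k + 1) * ∏ i : Fin (k + 1), a i.succ) := by gcongr
    _ = 2 * 4 ^ (k + 1) * P ^ (k + 1) * (a 0 * ∏ i : Fin (k + 1), a i.succ) := by ring
    _ ≤ 2 * 4 ^ (k + 1) * P ^ (k + 1) * (((k + 2 : ℕ) : ℝ) ^ (k + 2) * V) := by gcongr
    _ = _ := by ring
end

section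
/- Let E ⊂ ℝⁿ be a nearly spherical set parametrized by v ∈ W^{1,∞}(S^{n-1}) with ‖v‖_{W^{1,∞}} ≤ 1/2. Then its perimeter equals P(E) = ∫_{S^{n-1}} (1+v(x))^{n-2} √((1+v(x))² + |D_τ v(x)|²) dH^{n-1}, where D_τ v is the tangential gradient of v on the sphere. -/
open MeasureTheory Metric

/-- The unit sphere `S^{n-1}` in `ℝⁿ`. -/
def sphereS (n : ℕ) : Set (EuclideanSpace ℝ (Fin n)) := Metric.sphere 0 1

/-- The tangential gradient of a function on the sphere, computed as the gradient of
its 0-homogeneous extension `x ↦ v(x/‖x‖)`. -/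
noncomputable def tGrad (n : ℕ) (v : EuclideanSpace ℝ (Fin n) → ℝ)
    (x : EuclideanSpace ℝ (Fin n)) : EuclideanSpace ℝ (Fin n) :=
  gradient (fun y => v (‖y‖⁻¹ • y)) x

/-- The `W^{1,∞}(S^{n-1})` norm: supremum over the sphere of `max(|v|, |D_τ v|)`. -/
noncomputable def w1inf (n : ℕ) (v : EuclideanSpace ℝ (Fin n) → ℝ) : ℝ :=
  ⨆ x : sphereS n, max |v x.1| ‖tGrad n v x.1‖

/-- The nearly spherical set parametrized by `v`: the open star-shaped set whose
boundary is `{x(1+v(x)) : x ∈ S^{n-1}}`. -/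
def nsSet (n : ℕ) (v : EuclideanSpace ℝ (Fin n) → ℝ) :
    Set (EuclideanSpace ℝ (Fin n)) :=
  {y | y = 0 ∨ (y ≠ 0 ∧ ‖y‖ < 1 + v (‖y‖⁻¹ • y))}

/-- Membership of a function in `W^{1,∞}(S^{n-1})`, encoded as Lipschitz
continuity on the sphere. -/
def memW1inf (n : ℕ) (v : EuclideanSpace ℝ (Fin n) → ℝ) : Prop :=
  ∃ L : NNReal, LipschitzOnWith L v (sphereS n)


open MeasureTheory Metric Module Set Filter Topology
set_option linter.unusedSectionVars false
open scoped NNReal ENNReal RealInnerProductSpace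

lemma haus_le {X Y Z : Type*} [MetricSpace Y] [MetricSpace Z]
    [MeasurableSpace Y] [BorelSpace Y] [MeasurableSpace Z] [BorelSpace Z]
    (f : X → Y) (g : X → Z) (B : Set X) (K : ℝ≥0)
    (h : ∀ x ∈ B, ∀ z ∈ B, dist (f x) (f z) ≤ K * dist (g x) (g z)) {d : ℝ} (hd : 0 ≤ d) :
    μH[d] (f '' B) ≤ (K : ℝ≥0∞) ^ d * μH[d] (g '' B) := by
  rcases isEmpty_or_nonempty X with hX | hX
  · have : B = ∅ := Subsingleton.elim _ _
    simp [this]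
  have hinv : ∀ x ∈ B, Function.invFunOn g B (g x) ∈ B ∧
      g (Function.invFunOn g B (g x)) = g x := fun x hx =>
    ⟨Function.invFunOn_mem ⟨x, hx, rfl⟩, Function.invFunOn_eq ⟨x, hx, rfl⟩⟩
  have hl : LipschitzOnWith K (fun y => f (Function.invFunOn g B y)) (g '' B) := by
    apply LipschitzOnWith.of_dist_le_mul
    rintro _ ⟨x, hx, rfl⟩ _ ⟨z, hz, rfl⟩
    have := h _ (hinv x hx).1 _ (hinv z hz).1
    rwa [(hinv x hx).2, (hinv z hz).2] at this
  have := hl.hausdorffMeasure_image_le hd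
  refine le_trans (measure_mono ?_) this
  rintro _ ⟨x, hx, rfl⟩
  refine ⟨g x, ⟨x, hx, rfl⟩, ?_⟩
  have := h _ (hinv x hx).1 _ hx
  rw [(hinv x hx).2, dist_self, mul_zero] at this
  exact dist_le_zero.1 this

section lin
variable {E : Type*} [NormedAddCommGroup E] [InnerProductSpace ℝ E] [FiniteDimensional ℝ E]

/-- The derivative of the radial graph map, at `y`. -/
noncomputable def AA (a : ℝ) (g y : E) : E →L[ℝ] E :=
  a • ContinuousLinearMap.id ℝ E + (innerSL ℝ g).smulRight y

lemma AA_apply (a : ℝ) (g y w : E) : AA a g y w = a • w + ⟪g, w⟫ • y := by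
  simp [AA]

noncomputable def TT (a : ℝ) (g y : E) : (ℝ ∙ y)ᗮ →ₗ[ℝ] E :=
  (AA a g y).toLinearMap ∘ₗ ((ℝ ∙ y)ᗮ).subtype

lemma normDet_TT (a : ℝ) (ha : 0 < a) (g y : E) (hy : ‖y‖ = 1) (hg : ⟪y, g⟫ = 0) (n : ℕ)
    (hn : 2 ≤ n) (hE : finrank ℝ E = n) :
    (TT a g y).normDet = a ^ (n - 2) * Real.sqrt (a ^ 2 + ‖g‖ ^ 2) := by
  have hy0 : y ≠ 0 := by rintro rfl; simp at hy
  have hfr : finrank ℝ (ℝ ∙ y)ᗮ = n - 1 := by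
    have := Submodule.finrank_add_finrank_orthogonal (ℝ ∙ y)
    rw [finrank_span_singleton hy0] at this
    omega
  have hgW : g ∈ (ℝ ∙ y)ᗮ := by rwa [Submodule.mem_orthogonal_singleton_iff_inner_right]
  have key : (TT a g y).adjoint ∘ₗ (TT a g y) =
      (a ^ 2) • LinearMap.transvection
        ((a ^ 2)⁻¹ • (innerSL ℝ (⟨g, hgW⟩ : (ℝ ∙ y)ᗮ)).toLinearMap) ⟨g, hgW⟩ := by
    ext1 w
    apply ext_inner_right ℝ
    intro u
    have hw : ⟪y, (w : E)⟫ = 0 := (Submodule.mem_orthogonal_singleton_iff_inner_right).1 w.2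
    have hu : ⟪y, (u : E)⟫ = 0 := (Submodule.mem_orthogonal_singleton_iff_inner_right).1 u.2
    rw [LinearMap.comp_apply, LinearMap.adjoint_inner_left]
    simp only [TT, LinearMap.comp_apply, ContinuousLinearMap.coe_coe, AA_apply,
      Submodule.subtype_apply, LinearMap.smul_apply, LinearMap.transvection.apply, inner_add_left,
      inner_add_right, inner_smul_left, inner_smul_right, Submodule.coe_inner,
      innerSL_apply_apply, hu, real_inner_comm y (w : E), hw,
      real_inner_self_eq_norm_sq, hy, smul_eq_mul]
    simp
    field_simp
  have h2 := (TT a g y).normDet_sq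
  rw [key, LinearMap.det_smul, LinearMap.transvection.det, hfr] at h2
  have h3 : (TT a g y).normDet ^ 2 = (a ^ (n - 2) * Real.sqrt (a ^ 2 + ‖g‖ ^ 2)) ^ 2 := by
    rw [mul_pow, Real.sq_sqrt (by positivity)]
    have h2' : (TT a g y).normDet ^ 2 = _ := h2
    rw [h2']
    simp only [LinearMap.smul_apply, ContinuousLinearMap.coe_coe, innerSL_apply_apply,
      Submodule.coe_inner, real_inner_self_eq_norm_sq, smul_eq_mul]
    obtain ⟨k, rfl⟩ := Nat.exists_eq_add_of_le hn
    have : 2 + k - 1 = k + 1 := by omega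
    rw [this]
    simp only [Nat.add_sub_cancel_left]
    field_simp
    ring
  exact (sq_eq_sq₀ (LinearMap.normDet_nonneg _) (by positivity)).1 h3

end lin

section piece
variable {E : Type*} [NormedAddCommGroup E] [InnerProductSpace ℝ E] [FiniteDimensional ℝ E]
  [MeasurableSpace E] [BorelSpace E]

lemma norm_AA_sq (a : ℝ) (g y w : E) (hy : ‖y‖ = 1) (hw : ⟪y, w⟫ = 0) :
    ‖AA a g y w‖ ^ 2 = a ^ 2 * ‖w‖ ^ 2 + ⟪g, w⟫ ^ 2 := by
  rw [AA_apply, norm_add_sq_real, norm_smul, norm_smul, hy, inner_smul_left, inner_smul_right,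
    real_inner_comm y w, hw]
  simp [mul_pow]

/-- Main estimate on a small piece. -/
lemma piece_est (F : E → E) (B : Set E) (a : ℝ) (g y : E) (hy : ‖y‖ = 1) (hg : ⟪y, g⟫ = 0)
    (ha : 1 / 2 ≤ a) (ha' : a ≤ 3 / 2) (hgn : ‖g‖ ≤ 1 / 2)
    (n : ℕ) (hn : 2 ≤ n) (hE : finrank ℝ E = n)
    (δ : ℝ≥0) (hδ : δ < 1 / 32) (hB : ∀ x ∈ B, ‖x‖ = 1 ∧ dist x y ≤ δ)
    (hF : ApproximatesLinearOn F (AA a g y) B δ) :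
    μH[(n : ℝ) - 1] (F '' B) ≤ ((1 + 16 * δ : ℝ≥0) : ℝ≥0∞) ^ ((n : ℝ) - 1) *
      (ENNReal.ofReal (a ^ (n - 2) * Real.sqrt (a ^ 2 + ‖g‖ ^ 2)) * μH[(n : ℝ) - 1] B) ∧
    ENNReal.ofReal (a ^ (n - 2) * Real.sqrt (a ^ 2 + ‖g‖ ^ 2)) * μH[(n : ℝ) - 1] B ≤
      (((1 - δ)⁻¹ : ℝ≥0) : ℝ≥0∞) ^ ((n : ℝ) - 1) * 
      ((((1 - 16 * δ)⁻¹ : ℝ≥0) : ℝ≥0∞) ^ ((n : ℝ) - 1) * μH[(n : ℝ) - 1] (F '' B)) := by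
  have hy0 : y ≠ 0 := by rintro rfl; simp at hy
  have hfr : finrank ℝ (ℝ ∙ y)ᗮ = n - 1 := by
    have := Submodule.finrank_add_finrank_orthogonal (ℝ ∙ y)
    rw [finrank_span_singleton hy0] at this
    omega
  have hfr' : (finrank ℝ (ℝ ∙ y)ᗮ : ℝ) = (n : ℝ) - 1 := by
    rw [hfr, Nat.cast_sub (by omega)]; simp
  have hd : (0 : ℝ) ≤ (n : ℝ) - 1 := by rw [← hfr']; positivity
  have hδ1 : (δ : ℝ) < 1 / 32 := by exact_mod_cast hδ
  have hδ0 : (0 : ℝ) ≤ δ := δ.2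
  set W := (ℝ ∙ y)ᗮ with hW
  let P : E → W := fun x => W.orthogonalProjectionOnto x
  let Q : E → E := fun x => TT a g y (P x)
  have hlin : μH[(n : ℝ) - 1] (Q '' B) =
      ENNReal.ofReal (a ^ (n - 2) * Real.sqrt (a ^ 2 + ‖g‖ ^ 2)) * μH[(n : ℝ) - 1] (P '' B) := by
    rw [← normDet_TT a (by linarith) g y hy hg n hn hE, ← hfr', ← LinearMap.hausdorffMeasure_image,
      image_image]
  have hPE : ∀ x, ((P x : W) : E) = x - ⟪y, x⟫ • y := by
    intro x
    have h1 := Submodule.starProjection_orthogonal_val (K := ℝ ∙ y) x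
    have h2 := Submodule.starProjection_unit_singleton ℝ hy x
    rw [h2] at h1
    exact h1
  -- key facts for pairs
  have hpair : ∀ x ∈ B, ∀ z ∈ B, |⟪y, x - z⟫| ≤ δ * ‖x - z‖ := by
    intro x hx z hz
    have e : ⟪y, x - z⟫ = ⟪y - (1 / 2 : ℝ) • (x + z), x - z⟫ := by
      rw [inner_sub_left, inner_smul_left, inner_add_left, inner_sub_right x, inner_sub_right z,
        real_inner_self_eq_norm_sq, real_inner_self_eq_norm_sq, (hB x hx).1, (hB z hz).1,
        real_inner_comm x z]
      simp
    rw [e]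
    refine (abs_real_inner_le_norm _ _).trans ?_
    gcongr
    have : y - (1 / 2 : ℝ) • (x + z) = (1 / 2 : ℝ) • (y - x) + (1 / 2 : ℝ) • (y - z) := by
      module
    rw [this]
    refine (norm_add_le _ _).trans ?_
    rw [norm_smul, norm_smul]
    have h1 := (hB x hx).2
    have h2 := (hB z hz).2
    rw [dist_comm, dist_eq_norm] at h1 h2
    norm_num
    linarith
  have hPn : ∀ x ∈ B, ∀ z ∈ B, (1 - δ) * ‖x - z‖ ≤ ‖P x - P z‖ := by
    intro x hx z hz
    have e : ((P x - P z : W) : E) = (x - z) - ⟪y, x - z⟫ • y := by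
      rw [Submodule.coe_sub, hPE, hPE, inner_sub_right]; module
    rw [← Submodule.norm_coe, e]
    have := norm_sub_norm_le (x - z) (⟪y, x - z⟫ • y)
    rw [norm_smul, hy, Real.norm_eq_abs] at this
    have := hpair x hx z hz
    linarith
  have hPn' : ∀ x z, ‖P x - P z‖ ≤ ‖x - z‖ := by
    intro x z
    have := W.lipschitzWith_orthogonalProjectionOnto.dist_le_mul x z
    rw [dist_eq_norm, dist_eq_norm, NNReal.coe_one, one_mul] at this
    exact this
  have hQe : ∀ x z, Q x - Q z = AA a g y ((P x - P z : W) : E) := by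
    intro x z
    change TT a g y (P x) - TT a g y (P z) = _
    rw [← map_sub]; rfl
  have hQn : ∀ x z, ‖P x - P z‖ ≤ 2 * ‖Q x - Q z‖ := by
    intro x z
    rw [hQe]
    have h1 : ⟪y, ((P x - P z : W) : E)⟫ = 0 :=
      (Submodule.mem_orthogonal_singleton_iff_inner_right).1 (P x - P z).2
    have h2 := norm_AA_sq a g y _ hy h1
    rw [Submodule.norm_coe] at h2
    refine (sq_le_sq₀ (by positivity) (by positivity)).1 ?_
    rw [mul_pow, h2]
    have h3 : 1 / 4 ≤ a ^ 2 := by nlinarith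
    have h4 : 1 / 4 * ‖P x - P z‖ ^ 2 ≤ a ^ 2 * ‖P x - P z‖ ^ 2 := by gcongr
    nlinarith [sq_nonneg ⟪g, ((P x - P z : W) : E)⟫]
  have hFQ : ∀ x ∈ B, ∀ z ∈ B, ‖(F x - F z) - (Q x - Q z)‖ ≤ 16 * δ * ‖Q x - Q z‖ := by
    intro x hx z hz
    have h1 := hF x hx z hz
    have e : (F x - F z) - (Q x - Q z) =
        (F x - F z - AA a g y (x - z)) + ⟪y, x - z⟫ • AA a g y y := by
      rw [hQe, Submodule.coe_sub, hPE, hPE, ← map_smul, inner_sub_right]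
      rw [show x - ⟪y, x⟫ • y - (z - ⟪y, z⟫ • y) = (x - z) - (⟪y, x⟫ - ⟪y, z⟫) • y by module]
      rw [map_sub (AA a g y)]
      abel
    rw [e]
    have hAy : ‖AA a g y y‖ ≤ 3 / 2 := by
      rw [AA_apply, real_inner_comm, hg, zero_smul, add_zero, norm_smul, hy, Real.norm_eq_abs,
        abs_of_nonneg (by linarith)]
      linarith
    have h3 := norm_add_le (F x - F z - AA a g y (x - z)) (⟪y, x - z⟫ • AA a g y y)
    rw [norm_smul, Real.norm_eq_abs] at h3
    have h4 := hpair x hx z hz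
    have h5 : |⟪y, x - z⟫| * ‖AA a g y y‖ ≤ δ * ‖x - z‖ * (3 / 2) := by gcongr
    have h6 := hPn x hx z hz
    have h7 := hQn x z
    have h8 : ‖x - z‖ ≤ 4 * ‖Q x - Q z‖ := by nlinarith [norm_nonneg (x - z)]
    have h9 : δ * ‖x - z‖ ≤ δ * (4 * ‖Q x - Q z‖) := by gcongr
    nlinarith [norm_nonneg (Q x - Q z)]
  have c1 : ((1 - 16 * δ : ℝ≥0) : ℝ) = 1 - 16 * δ := by
    rw [NNReal.coe_sub]
    · simp
    · rw [← NNReal.coe_le_coe]; push_cast; linarith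
  have c2 : ((1 - δ : ℝ≥0) : ℝ) = 1 - δ := by
    rw [NNReal.coe_sub]
    · simp
    · rw [← NNReal.coe_le_coe]; push_cast; linarith
  constructor
  · have h1 := haus_le F Q B (1 + 16 * δ) (by
      intro x hx z hz
      rw [dist_eq_norm, dist_eq_norm]
      have h1 := hFQ x hx z hz
      have h2 := norm_le_norm_add_norm_sub (Q x - Q z) (F x - F z)
      rw [norm_sub_rev] at h2
      push_cast
      rw [norm_sub_rev] at h2
      rw [norm_sub_rev] at h1
      linarith [norm_sub_rev (F x - F z) (Q x - Q z)]) hd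
    refine h1.trans ?_
    gcongr
    rw [hlin]
    gcongr
    have := haus_le P id B 1 (by
      intro x _ z _
      rw [dist_eq_norm, dist_eq_norm]
      simpa using hPn' x z) hd
    simpa using this
  · have h1 := haus_le id P B ((1 - δ)⁻¹) (by
      intro x hx z hz
      rw [dist_eq_norm, dist_eq_norm, NNReal.coe_inv, c2, inv_mul_eq_div, le_div_iff₀ (by linarith)]
      have := hPn x hx z hz
      simp only [id]
      linarith) hd
    have h2 := haus_le Q F B ((1 - 16 * δ)⁻¹) (by
      intro x hx z hz
      rw [dist_eq_norm, dist_eq_norm, NNReal.coe_inv, c1, inv_mul_eq_div, le_div_iff₀ (by linarith)]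
      have h1 := hFQ x hx z hz
      have h2 := norm_sub_norm_le (Q x - Q z) (F x - F z)
      rw [norm_sub_rev] at h1
      linarith) hd
    rw [image_id] at h1
    calc _ ≤ ENNReal.ofReal (a ^ (n - 2) * Real.sqrt (a ^ 2 + ‖g‖ ^ 2)) *
          ((((1 - δ)⁻¹ : ℝ≥0) : ℝ≥0∞) ^ ((n : ℝ) - 1) * μH[(n : ℝ) - 1] (P '' B)) := by gcongr
      _ = (((1 - δ)⁻¹ : ℝ≥0) : ℝ≥0∞) ^ ((n : ℝ) - 1) * μH[(n : ℝ) - 1] (Q '' B) := by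
          rw [hlin]; ring
      _ ≤ _ := by gcongr

end piece

section area
variable {E : Type*} [NormedAddCommGroup E] [InnerProductSpace ℝ E] [FiniteDimensional ℝ E]
  [MeasurableSpace E] [BorelSpace E]

lemma glue (F : E → E) (J : E → ℝ≥0∞) (d : ℝ) (C1 C2 : ℝ≥0∞) (s : Set E) (hs : MeasurableSet s)
    (hc : ContinuousOn F s) (hi : InjOn F s) (t : ℕ → Set E) (ht : ∀ k, MeasurableSet (t k))
    (hd : Pairwise (Function.onFun Disjoint t)) (hst : s ⊆ ⋃ k, t k)
    (h : ∀ k, μH[d] (F '' (s ∩ t k)) ≤ C1 * ∫⁻ x in s ∩ t k, J x ∂μH[d] ∧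
      ∫⁻ x in s ∩ t k, J x ∂μH[d] ≤ C2 * μH[d] (F '' (s ∩ t k))) :
    μH[d] (F '' s) ≤ C1 * ∫⁻ x in s, J x ∂μH[d] ∧
      ∫⁻ x in s, J x ∂μH[d] ≤ C2 * μH[d] (F '' s) := by
  have e : s = ⋃ k, s ∩ t k := by rw [← inter_iUnion, inter_eq_left.2 hst]
  have hm : ∀ k, MeasurableSet (s ∩ t k) := fun k => hs.inter (ht k)
  have hd' : Pairwise (Function.onFun Disjoint fun k => s ∩ t k) := fun i j hij =>
    (hd hij).mono inter_subset_right inter_subset_right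
  have e1 : μH[d] (F '' s) = ∑' k, μH[d] (F '' (s ∩ t k)) := by
    conv_lhs => rw [e, image_iUnion]
    refine measure_iUnion ?_ ?_
    · intro i j hij
      exact (hd' hij).image hi inter_subset_left inter_subset_left
    · intro k
      exact (hm k).image_of_continuousOn_injOn (hc.mono inter_subset_left)
        (hi.mono inter_subset_left)
  have e2 : ∫⁻ x in s, J x ∂μH[d] = ∑' k, ∫⁻ x in s ∩ t k, J x ∂μH[d] := by
    conv_lhs => rw [e]
    exact lintegral_iUnion hm hd' _
  rw [e1, e2, ← ENNReal.tsum_mul_left, ← ENNReal.tsum_mul_left]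
  exact ⟨ENNReal.tsum_le_tsum fun k => (h k).1, ENNReal.tsum_le_tsum fun k => (h k).2⟩

noncomputable def JJ (n : ℕ) (a : ℝ) (g : E) : ℝ := a ^ (n - 2) * Real.sqrt (a ^ 2 + ‖g‖ ^ 2)

lemma JJ_lower (n : ℕ) (a : ℝ) (g : E) (ha : 1 / 2 ≤ a) :
    (1 / 2 : ℝ) ^ (n - 2) * (1 / 2) ≤ JJ n a g := by
  unfold JJ
  gcongr
  apply Real.le_sqrt_of_sq_le
  nlinarith [sq_nonneg ‖g‖]

noncomputable def CC1 (m : ℝ) (δ : ℝ≥0) : ℝ≥0∞ :=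
  ((1 + 16 * δ : ℝ≥0) : ℝ≥0∞) ^ m * ((1 + δ : ℝ≥0) : ℝ≥0∞)
noncomputable def CC2 (m : ℝ) (δ : ℝ≥0) : ℝ≥0∞ :=
  ((1 + δ : ℝ≥0) : ℝ≥0∞) * ((((1 - δ)⁻¹ : ℝ≥0) : ℝ≥0∞) ^ m * (((1 - 16 * δ)⁻¹ : ℝ≥0) : ℝ≥0∞) ^ m)

lemma tendsto_CC1 (m : ℝ) (hm : 0 ≤ m) : Tendsto (CC1 m) (𝓝[>] 0) (𝓝 1) := by
  have : Tendsto (fun δ : ℝ≥0 => ((((1 + 16 * δ) ^ m * (1 + δ) : ℝ≥0)) : ℝ≥0∞)) (𝓝 0) (𝓝 1) := by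
    rw [← ENNReal.coe_one, ENNReal.tendsto_coe]
    have : ContinuousAt (fun δ : ℝ≥0 => ((1 + 16 * δ) ^ m * (1 + δ) : ℝ≥0)) 0 := by
      refine ContinuousAt.mul (ContinuousAt.comp (f := fun δ : ℝ≥0 => 1 + 16 * δ)
        (g := fun x : ℝ≥0 => x ^ m) ?_ (by fun_prop)) (by fun_prop)
      exact NNReal.continuousAt_rpow_const (Or.inr hm)
    have h := this.tendsto
    simpa using h
  refine (this.mono_left nhdsWithin_le_nhds).congr fun δ => ?_
  rw [CC1, ENNReal.coe_mul, ENNReal.coe_rpow_of_nonneg _ hm]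

lemma tendsto_CC2 (m : ℝ) (hm : 0 ≤ m) : Tendsto (CC2 m) (𝓝[>] 0) (𝓝 1) := by
  have : Tendsto (fun δ : ℝ≥0 => ((((1 + δ) * (((1 - δ)⁻¹) ^ m * ((1 - 16 * δ)⁻¹) ^ m) : ℝ≥0)) : ℝ≥0∞))
      (𝓝 0) (𝓝 1) := by
    rw [← ENNReal.coe_one, ENNReal.tendsto_coe]
    have : ContinuousAt (fun δ : ℝ≥0 => ((1 + δ) * (((1 - δ)⁻¹) ^ m * ((1 - 16 * δ)⁻¹) ^ m) : ℝ≥0)) 0 := by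
      refine ContinuousAt.mul (by fun_prop) (ContinuousAt.mul ?_ ?_)
      · refine ContinuousAt.comp (f := fun δ : ℝ≥0 => (1 - δ)⁻¹)
          (g := fun x : ℝ≥0 => x ^ m) (NNReal.continuousAt_rpow_const (Or.inr hm)) ?_
        exact ContinuousAt.inv₀ (by fun_prop) (by simp)
      · refine ContinuousAt.comp (f := fun δ : ℝ≥0 => (1 - 16 * δ)⁻¹)
          (g := fun x : ℝ≥0 => x ^ m) (NNReal.continuousAt_rpow_const (Or.inr hm)) ?_
        exact ContinuousAt.inv₀ (by fun_prop) (by simp)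
    have h := this.tendsto
    simpa using h
  refine (this.mono_left nhdsWithin_le_nhds).congr fun δ => ?_
  rw [CC2, ENNReal.coe_mul, ENNReal.coe_mul, ENNReal.coe_rpow_of_nonneg _ hm,
    ENNReal.coe_rpow_of_nonneg _ hm]

lemma area_est (F : E → E) (a : E → ℝ) (g : E → E) (s : Set E) (hs : MeasurableSet s)
    (n : ℕ) (hn : 2 ≤ n) (hE : finrank ℝ E = n)
    (hc : ContinuousOn F s) (hi : InjOn F s) (hJ : Measurable fun x => JJ n (a x) (g x))
    (hsS : ∀ x ∈ s, ‖x‖ = 1) (hg : ∀ x ∈ s, ⟪x, g x⟫ = 0)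
    (ha : ∀ x ∈ s, 1 / 2 ≤ a x) (ha' : ∀ x ∈ s, a x ≤ 3 / 2) (hgn : ∀ x ∈ s, ‖g x‖ ≤ 1 / 2)
    (hF : ∀ x ∈ s, HasFDerivAt F (AA (a x) (g x) x) x)
    (δ : ℝ≥0) (hδ0 : 0 < δ) (hδ : δ < 1 / 32) :
    μH[(n : ℝ) - 1] (F '' s) ≤ CC1 ((n : ℝ) - 1) δ *
      ∫⁻ x in s, ENNReal.ofReal (JJ n (a x) (g x)) ∂μH[(n : ℝ) - 1] ∧
    ∫⁻ x in s, ENNReal.ofReal (JJ n (a x) (g x)) ∂μH[(n : ℝ) - 1] ≤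
      CC2 ((n : ℝ) - 1) δ * μH[(n : ℝ) - 1] (F '' s) := by
  set c0 : ℝ := (1 / 2 : ℝ) ^ (n - 2) * (1 / 2) with hc0
  have hc0p : 0 < c0 := by positivity
  have hc01 : c0 ≤ 1 := by
    have : (1 / 2 : ℝ) ^ (n - 2) ≤ 1 := pow_le_one₀ (by norm_num) (by norm_num)
    rw [hc0]; linarith
  have hδr : (0 : ℝ) < δ := by exact_mod_cast hδ0
  let Ψ : E → E × ℝ := fun x => (x, JJ n (a x) (g x))
  have hΨ : Measurable Ψ := measurable_id.prodMk hJ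
  let ρ : ℝ := δ * c0 / 2
  have hρ : 0 < ρ := by positivity
  let u : ℕ → Set E := fun k => Ψ ⁻¹' ball (TopologicalSpace.denseSeq (E × ℝ) k) ρ
  have hu : ∀ k, MeasurableSet (u k) := fun k => hΨ measurableSet_ball
  have hucov : ⋃ k, u k = univ := by
    rw [eq_univ_iff_forall]
    intro x
    obtain ⟨k, hk⟩ := (TopologicalSpace.denseRange_denseSeq (E × ℝ)).exists_dist_lt (Ψ x) hρ
    exact mem_iUnion.2 ⟨k, hk⟩
  refine glue F _ _ _ _ s hs hc hi (disjointed u) (fun k => MeasurableSet.disjointed hu k)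
    (disjoint_disjointed u) (by rw [iUnion_disjointed, hucov]; exact subset_univ _) ?_
  intro k
  set s' := s ∩ disjointed u k with hs'
  have hs's : s' ⊆ s := inter_subset_left
  have hs'm : MeasurableSet s' := hs.inter (MeasurableSet.disjointed hu k)
  rcases s'.eq_empty_or_nonempty with h0 | hne
  · simp [h0]
  have hclose : ∀ x ∈ s', ∀ y ∈ s', dist x y ≤ δ ∧
      |JJ n (a x) (g x) - JJ n (a y) (g y)| ≤ δ * c0 := by
    intro x hx y hy
    have h1 : dist (Ψ x) (TopologicalSpace.denseSeq (E × ℝ) k) < ρ := disjointed_subset u k hx.2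
    have h2 : dist (Ψ y) (TopologicalSpace.denseSeq (E × ℝ) k) < ρ := disjointed_subset u k hy.2
    have h3 : dist (Ψ x) (Ψ y) ≤ δ * c0 := by
      have := dist_triangle_right (Ψ x) (Ψ y) (TopologicalSpace.denseSeq (E × ℝ) k)
      have e : δ * c0 = ρ + ρ := by simp only [ρ]; ring
      linarith
    rw [Prod.dist_eq] at h3
    have h4 := (le_max_left _ _).trans h3
    have h5 := (le_max_right _ _).trans h3
    refine ⟨h4.trans ?_, h5⟩
    nlinarith
  obtain ⟨t, A, htd, htm, htc, hta, htA⟩ :=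
    exists_partition_approximatesLinearOn_of_hasFDerivWithinAt F s' (fun x => AA (a x) (g x) x)
      (fun x hx => (hF x (hs's hx)).hasFDerivWithinAt) (fun _ => δ) (fun _ => hδ0.ne')
  refine glue F _ _ _ _ s' hs'm (hc.mono hs's) (hi.mono hs's) t htm htd htc ?_
  intro j
  obtain ⟨y, hy, hAy⟩ := htA hne j
  have hap := hta j
  rw [hAy] at hap
  have hys := hs's hy
  obtain ⟨p1, p2⟩ := piece_est F (s' ∩ t j) (a y) (g y) y (hsS y hys) (hg y hys) (ha y hys)
    (ha' y hys) (hgn y hys) n hn hE δ hδ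
    (fun x hx => ⟨hsS x (hs's hx.1), (hclose x hx.1 y hy).1⟩) hap
  change _ ≤ _ * (ENNReal.ofReal (JJ n (a y) (g y)) * _) at p1
  change ENNReal.ofReal (JJ n (a y) (g y)) * _ ≤ _ at p2
  have hBm : MeasurableSet (s' ∩ t j) := hs'm.inter (htm j)
  have hcoe : ((1 + δ : ℝ≥0) : ℝ≥0∞) = ENNReal.ofReal (1 + δ) := by
    rw [← ENNReal.ofReal_coe_nnreal]; simp
  have q1 : ENNReal.ofReal (JJ n (a y) (g y)) * μH[(n : ℝ) - 1] (s' ∩ t j) ≤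
      ((1 + δ : ℝ≥0) : ℝ≥0∞) *
        ∫⁻ x in s' ∩ t j, ENNReal.ofReal (JJ n (a x) (g x)) ∂μH[(n : ℝ) - 1] := by
    rw [← setLIntegral_const, ← lintegral_const_mul _ hJ.ennreal_ofReal]
    refine setLIntegral_mono' hBm fun x hx => ?_
    rw [hcoe, ← ENNReal.ofReal_mul (by positivity)]
    refine ENNReal.ofReal_le_ofReal ?_
    have h1 := abs_le.1 (hclose x hx.1 y hy).2
    have h2 := JJ_lower n (a x) (g x) (ha x (hs's hx.1))
    have h3 : δ * c0 ≤ δ * JJ n (a x) (g x) := by gcongr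
    linarith [h1.1]
  have q2 : ∫⁻ x in s' ∩ t j, ENNReal.ofReal (JJ n (a x) (g x)) ∂μH[(n : ℝ) - 1] ≤
      ((1 + δ : ℝ≥0) : ℝ≥0∞) *
      (ENNReal.ofReal (JJ n (a y) (g y)) * μH[(n : ℝ) - 1] (s' ∩ t j)) := by
    rw [← mul_assoc, ← setLIntegral_const]
    refine setLIntegral_mono' hBm fun x hx => ?_
    rw [hcoe, ← ENNReal.ofReal_mul (by positivity)]
    refine ENNReal.ofReal_le_ofReal ?_
    have h1 := abs_le.1 (hclose x hx.1 y hy).2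
    have h2 := JJ_lower n (a y) (g y) (ha y hys)
    have h3 : δ * c0 ≤ δ * JJ n (a y) (g y) := by gcongr
    linarith [h1.2]
  constructor
  · refine p1.trans ?_
    rw [CC1, mul_assoc]
    gcongr
  · refine q2.trans ?_
    rw [CC2, mul_assoc, mul_assoc]
    gcongr

lemma area (F : E → E) (a : E → ℝ) (g : E → E) (s : Set E) (hs : MeasurableSet s)
    (n : ℕ) (hn : 2 ≤ n) (hE : finrank ℝ E = n)
    (hc : ContinuousOn F s) (hi : InjOn F s) (hJ : Measurable fun x => JJ n (a x) (g x))
    (hsS : ∀ x ∈ s, ‖x‖ = 1) (hg : ∀ x ∈ s, ⟪x, g x⟫ = 0)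
    (ha : ∀ x ∈ s, 1 / 2 ≤ a x) (ha' : ∀ x ∈ s, a x ≤ 3 / 2) (hgn : ∀ x ∈ s, ‖g x‖ ≤ 1 / 2)
    (hF : ∀ x ∈ s, HasFDerivAt F (AA (a x) (g x) x) x) :
    μH[(n : ℝ) - 1] (F '' s) =
      ∫⁻ x in s, ENNReal.ofReal (JJ n (a x) (g x)) ∂μH[(n : ℝ) - 1] := by
  have hm : (0 : ℝ) ≤ (n : ℝ) - 1 := by
    have : (2 : ℝ) ≤ n := by exact_mod_cast hn
    linarith
  have hev : ∀ᶠ δ : ℝ≥0 in 𝓝[>] 0, 0 < δ ∧ δ < 1 / 32 := by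
    refine (eventually_mem_nhdsWithin).and ?_
    exact nhdsWithin_le_nhds (Iio_mem_nhds (by norm_num))
  apply le_antisymm
  · have := ENNReal.Tendsto.mul_const (b := ∫⁻ x in s, ENNReal.ofReal (JJ n (a x) (g x))
      ∂μH[(n : ℝ) - 1]) (tendsto_CC1 _ hm) (Or.inl one_ne_zero)
    rw [one_mul] at this
    refine ge_of_tendsto this (hev.mono fun δ hδ => ?_)
    exact (area_est F a g s hs n hn hE hc hi hJ hsS hg ha ha' hgn hF δ hδ.1 hδ.2).1
  · have := ENNReal.Tendsto.mul_const (b := μH[(n : ℝ) - 1] (F '' s)) (tendsto_CC2 _ hm)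
      (Or.inl one_ne_zero)
    rw [one_mul] at this
    refine ge_of_tendsto this (hev.mono fun δ hδ => ?_)
    exact (area_est F a g s hs n hn hE hc hi hJ hsS hg ha ha' hgn hF δ hδ.1 hδ.2).2

end area

section sph
variable {E : Type*} [NormedAddCommGroup E] [InnerProductSpace ℝ E] [FiniteDimensional ℝ E]
  [MeasurableSpace E] [BorelSpace E]

lemma dir_lip (y z : E) (hy : y ≠ 0) (hz : z ≠ 0) :
    ‖‖y‖⁻¹ • y - ‖z‖⁻¹ • z‖ ≤ 2 * ‖y‖⁻¹ * ‖y - z‖ := by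
  have hy' : 0 < ‖y‖ := norm_pos_iff.2 hy
  have hz' : 0 < ‖z‖ := norm_pos_iff.2 hz
  have e : ‖y‖⁻¹ • y - ‖z‖⁻¹ • z = ‖y‖⁻¹ • (y - z) + (‖y‖⁻¹ - ‖z‖⁻¹) • z := by module
  rw [e]
  refine (norm_add_le _ _).trans ?_
  rw [norm_smul, norm_smul, norm_inv, norm_norm, Real.norm_eq_abs]
  have e2 : |‖y‖⁻¹ - ‖z‖⁻¹| * ‖z‖ = ‖y‖⁻¹ * |‖y‖ - ‖z‖| := by
    have : ‖y‖⁻¹ - ‖z‖⁻¹ = ‖y‖⁻¹ * ‖z‖⁻¹ * (‖z‖ - ‖y‖) := by field_simp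
    rw [this, abs_mul, abs_of_pos (by positivity : 0 < ‖y‖⁻¹ * ‖z‖⁻¹), abs_sub_comm]
    field_simp
  rw [e2]
  have := abs_norm_sub_norm_le y z
  have : ‖y‖⁻¹ * |‖y‖ - ‖z‖| ≤ ‖y‖⁻¹ * ‖y - z‖ := by gcongr
  linarith

noncomputable def vb (v : E → ℝ) (y : E) : ℝ := v (‖y‖⁻¹ • y)

lemma dir_mem (y : E) (hy : y ≠ 0) : ‖y‖⁻¹ • y ∈ sphere (0 : E) 1 := by
  simp [norm_smul, norm_ne_zero_iff.2 hy]

lemma vb_sphere (v : E → ℝ) (y : E) (hy : ‖y‖ = 1) : vb v y = v y := by simp [vb, hy]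

lemma vb_lip (v : E → ℝ) (L : ℝ≥0) (hv : LipschitzOnWith L v (sphere 0 1)) (r : ℝ≥0) (hr : 0 < r) :
    LipschitzOnWith (2 * L * r⁻¹) (vb v) {y | r ≤ ‖y‖} := by
  apply LipschitzOnWith.of_dist_le_mul
  intro y hy z hz
  have hr' : (0 : ℝ) < r := hr
  have hyr : (r : ℝ) ≤ ‖y‖ := hy
  have hzr : (r : ℝ) ≤ ‖z‖ := hz
  have hy0 : y ≠ 0 := norm_pos_iff.1 (hr'.trans_le hy)
  have hz0 : z ≠ 0 := norm_pos_iff.1 (hr'.trans_le hz)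
  have h1 := hv.dist_le_mul _ (dir_mem y hy0) _ (dir_mem z hz0)
  refine h1.trans ?_
  rw [dist_eq_norm, dist_eq_norm]
  have h2 := dir_lip y z hy0 hz0
  have h3 : ‖y‖⁻¹ ≤ (r : ℝ)⁻¹ := by gcongr
  push_cast
  calc (L : ℝ) * _ ≤ L * (2 * ‖y‖⁻¹ * ‖y - z‖) := by gcongr
    _ ≤ L * (2 * (r : ℝ)⁻¹ * ‖y - z‖) := by gcongr
    _ = _ := by ring

lemma vb_contAt (v : E → ℝ) (L : ℝ≥0) (hv : LipschitzOnWith L v (sphere 0 1)) (y : E) (hy : y ≠ 0) :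
    ContinuousAt (vb v) y := by
  have hy' : 0 < ‖y‖ := norm_pos_iff.2 hy
  have h := vb_lip v L hv (Real.toNNReal (‖y‖ / 2)) (by simpa using hy)
  rw [Real.coe_toNNReal _ (by positivity)] at h
  refine h.continuousOn.continuousAt ?_
  refine (continuous_norm.isOpen_preimage _ isOpen_Ioi).mem_nhds
    (show y ∈ (fun x : E => ‖x‖) ⁻¹' Ioi (‖y‖ / 2) by simpa using hy) |> fun h => mem_of_superset h ?_
  intro x hx
  exact le_of_lt (show ‖y‖ / 2 < ‖x‖ from hx)

lemma vb_measurable (v : E → ℝ) (L : ℝ≥0) (hv : LipschitzOnWith L v (sphere 0 1)) :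
    Measurable (vb v) := by
  apply measurable_of_continuousOn_compl_singleton 0
  intro y hy
  exact (vb_contAt v L hv y hy).continuousWithinAt

lemma vb_homog (v : E → ℝ) (t : ℝ) (ht : 0 < t) (y : E) : vb v (t • y) = vb v y := by
  unfold vb
  rw [norm_smul, Real.norm_of_nonneg ht.le, smul_smul]
  congr 2
  field_simp

lemma vb_grad_orth (v : E → ℝ) (x : E) (hx : DifferentiableAt ℝ (vb v) x) :
    ⟪x, gradient (vb v) x⟫ = 0 := by
  have h1 : HasFDerivAt (vb v) (fderiv ℝ (vb v) x) ((1 : ℝ) • x) := by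
    rw [one_smul]; exact hx.hasFDerivAt
  have h2 : HasDerivAt (fun t : ℝ => t • x) x 1 := by
    simpa using (hasDerivAt_id (1 : ℝ)).smul_const x
  have h3 := h1.comp_hasDerivAt (1 : ℝ) h2
  have h4 : HasDerivAt (vb v ∘ fun t : ℝ => t • x) 0 1 := by
    refine (hasDerivAt_const (1 : ℝ) (vb v x)).congr_of_eventuallyEq ?_
    filter_upwards [Ioi_mem_nhds (zero_lt_one' ℝ)] with t ht
    exact vb_homog v t ht x
  have h5 := h3.unique h4
  rw [real_inner_comm]
  rw [gradient, InnerProductSpace.toDual_symm_apply]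
  exact h5

lemma vb_null (v : E → ℝ) (L : ℝ≥0) (hv : LipschitzOnWith L v (sphere 0 1)) (n : ℕ) (hn : 2 ≤ n)
    (hE : finrank ℝ E = n) :
    μH[(n : ℝ) - 1] {x | x ∈ sphere (0 : E) 1 ∧ ¬ DifferentiableAt ℝ (vb v) x} = 0 := by
  apply measure_null_of_locally_null
  rintro y ⟨hy, -⟩
  have hy1 : ‖y‖ = 1 := by simpa using hy
  have hy0 : y ≠ 0 := by rintro rfl; simp at hy1
  have hfr : finrank ℝ (ℝ ∙ y)ᗮ = n - 1 := by
    have := Submodule.finrank_add_finrank_orthogonal (ℝ ∙ y)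
    rw [finrank_span_singleton hy0] at this
    omega
  have hfr' : (finrank ℝ (ℝ ∙ y)ᗮ : ℝ) = (n : ℝ) - 1 := by
    rw [hfr, Nat.cast_sub (by omega)]; simp
  have hd : (0 : ℝ) ≤ (n : ℝ) - 1 := by rw [← hfr']; positivity
  set W := (ℝ ∙ y)ᗮ with hW
  have hge : ∀ w : W, 1 ≤ ‖y + (w : E)‖ := by
    intro w
    have h1 : ⟪y, (w : E)⟫ = 0 := (Submodule.mem_orthogonal_singleton_iff_inner_right).1 w.2
    have h2 := abs_real_inner_le_norm y (y + (w : E))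
    rw [inner_add_right, h1, real_inner_self_eq_norm_sq, hy1] at h2
    simpa using h2
  let f : W → ℝ := fun w => vb v (y + w)
  have hf : LipschitzWith (2 * L) f := by
    have h := vb_lip v L hv 1 one_pos
    rw [inv_one, mul_one] at h
    refine LipschitzWith.of_dist_le_mul fun w w' => ?_
    have := h.dist_le_mul (y + w) (by simpa using hge w) (y + w') (by simpa using hge w')
    rw [dist_add_left] at this
    exact this
  let G : W → E := fun w => ‖y + (w : E)‖⁻¹ • (y + (w : E))
  have hG : LipschitzWith 2 G := by
    refine LipschitzWith.of_dist_le_mul fun w w' => ?_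
    have h0 : ∀ w : W, y + (w : E) ≠ 0 := fun w => norm_pos_iff.1 (one_pos.trans_le (hge w))
    have h1 := dir_lip _ _ (h0 w) (h0 w')
    rw [dist_eq_norm]
    refine h1.trans ?_
    have h2 : ‖y + (w : E)‖⁻¹ ≤ 1 := inv_le_one_of_one_le₀ (hge w)
    have h3 : ‖y + (w : E) - (y + (w' : E))‖ = dist w w' := by
      rw [add_sub_add_left_eq_sub, dist_eq_norm]; rfl
    rw [h3]
    have : (0 : ℝ) ≤ dist w w' := dist_nonneg
    push_cast
    nlinarith
  have hnull : μH[(n : ℝ) - 1] {w : W | ¬ DifferentiableAt ℝ f w} = 0 := by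
    have := hf.ae_differentiableAt (μ := μH[(finrank ℝ W : ℝ)])
    rw [hfr'] at this
    exact this
  have hGnull : μH[(n : ℝ) - 1] (G '' {w : W | ¬ DifferentiableAt ℝ f w}) = 0 := by
    have := hG.hausdorffMeasure_image_le hd {w : W | ¬ DifferentiableAt ℝ f w}
    rw [hnull, mul_zero] at this
    exact le_antisymm this bot_le
  have hopen : IsOpen {x : E | 0 < ⟪y, x⟫} :=
    isOpen_lt continuous_const (continuous_const.inner continuous_id)
  refine ⟨_, inter_mem_nhdsWithin _ (hopen.mem_nhds
    (show 0 < ⟪y, y⟫ by rw [real_inner_self_eq_norm_sq, hy1]; norm_num)), ?_⟩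
  refine measure_mono_null ?_ hGnull
  rintro x ⟨⟨hx, hxd⟩, hxy⟩
  have hxy' : 0 < ⟪y, x⟫ := hxy
  have hx1 : ‖x‖ = 1 := by simpa using hx
  let R : E → W := fun z => ⟪y, z⟫⁻¹ • W.orthogonalProjectionOnto z
  have hR : ∀ z, 0 < ⟪y, z⟫ → y + (R z : E) = ⟪y, z⟫⁻¹ • z := by
    intro z hz
    have h1 := Submodule.starProjection_orthogonal_val (K := ℝ ∙ y) z
    have h2 := Submodule.starProjection_unit_singleton ℝ hy1 z
    rw [h2] at h1
    have h3 : ((W.orthogonalProjectionOnto z : W) : E) = z - ⟪y, z⟫ • y := h1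
    change y + ((⟪y, z⟫⁻¹ • W.orthogonalProjectionOnto z : W) : E) = _
    rw [Submodule.coe_smul, h3, smul_sub, smul_smul, inv_mul_cancel₀ hz.ne', one_smul]
    abel
  refine ⟨R x, ?_, ?_⟩
  · intro hdf
    apply hxd
    have hRd : DifferentiableAt ℝ R x := by
      refine DifferentiableAt.smul (DifferentiableAt.inv ?_ hxy'.ne') ?_
      · exact (innerSL ℝ y).differentiableAt
      · exact (W.orthogonalProjectionOnto).differentiableAt
    have hcomp : DifferentiableAt ℝ (f ∘ R) x := hdf.comp x hRd
    refine hcomp.congr_of_eventuallyEq ?_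
    filter_upwards [hopen.mem_nhds hxy] with z hz
    change vb v z = vb v (y + (R z : E))
    rw [hR z hz, vb_homog v _ (inv_pos.2 hz)]
  · change ‖y + (R x : E)‖⁻¹ • (y + (R x : E)) = x
    rw [hR x hxy', norm_smul, hx1, norm_inv, Real.norm_of_nonneg hxy'.le, smul_smul]
    field_simp
    simp

noncomputable def FF (v : E → ℝ) (y : E) : E := (1 + vb v y) • y

lemma FF_deriv (v : E → ℝ) (x : E) (hx : DifferentiableAt ℝ (vb v) x) :
    HasFDerivAt (FF v) (AA (1 + vb v x) (gradient (vb v) x) x) x := by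
  have h := (hx.hasFDerivAt.const_add 1).smul (hasFDerivAt_id (𝕜 := ℝ) x)
  have e : AA (1 + vb v x) (gradient (vb v) x) x = (1 + vb v x) • ContinuousLinearMap.id ℝ E +
      (fderiv ℝ (vb v) x).smulRight (id x) := by
    ext w
    rw [AA_apply]
    simp [gradient]
  rw [e]
  exact h

lemma FF_inj (v : E → ℝ) (hv : ∀ x ∈ sphere (0 : E) 1, |v x| ≤ 1 / 2) :
    InjOn (FF v) (sphere 0 1) := by
  intro x hx z hz h
  have hx1 : ‖x‖ = 1 := by simpa using hx
  have hz1 : ‖z‖ = 1 := by simpa using hz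
  have a1 := abs_le.1 (hv x hx)
  have a2 := abs_le.1 (hv z hz)
  unfold FF at h
  rw [vb_sphere v x hx1, vb_sphere v z hz1] at h
  have hn := congrArg norm h
  rw [norm_smul, norm_smul, hx1, hz1, mul_one, mul_one, Real.norm_of_nonneg (by linarith),
    Real.norm_of_nonneg (by linarith)] at hn
  rw [hn] at h
  exact smul_right_injective E (by linarith : (1 + v z) ≠ 0) h

lemma frontier_eq (v : E → ℝ) (L : ℝ≥0) (hL : LipschitzOnWith L v (sphere 0 1))
    (hv : ∀ x ∈ sphere (0 : E) 1, |v x| ≤ 1 / 2) :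
    frontier {y : E | y = 0 ∨ (y ≠ 0 ∧ ‖y‖ < 1 + vb v y)} = FF v '' sphere 0 1 := by
  set N := {y : E | y = 0 ∨ (y ≠ 0 ∧ ‖y‖ < 1 + vb v y)} with hN
  have hb : ∀ y : E, y ≠ 0 → |vb v y| ≤ 1 / 2 := fun y hy => hv _ (dir_mem y hy)
  have hball : ball (0 : E) (1 / 2) ⊆ N := by
    intro y hy
    by_cases h : y = 0
    · exact Or.inl h
    · refine Or.inr ⟨h, ?_⟩
      have := abs_le.1 (hb y h)
      have hy' : ‖y‖ < 1 / 2 := by simpa using hy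
      linarith [this.1]
  have hopen : IsOpen N := by
    rw [isOpen_iff_mem_nhds]
    intro y hy
    by_cases h : y = 0
    · subst h
      exact mem_of_superset (ball_mem_nhds 0 (by norm_num)) hball
    · have hlt : ‖y‖ < 1 + vb v y := by
        rcases hy with hy | hy
        · exact absurd hy h
        · exact hy.2
      have hc : ContinuousAt (fun y => 1 + vb v y) y := (vb_contAt v L hL y h).const_add 1
      filter_upwards [continuous_norm.continuousAt.eventually_lt hc hlt, isOpen_ne.mem_nhds h]
        with z hz hz0
      exact Or.inr ⟨hz0, hz⟩
  rw [hopen.frontier_eq]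
  ext y
  constructor
  · rintro ⟨hyc, hyN⟩
    have h0 : y ≠ 0 := fun h => hyN (Or.inl h)
    have hle : 1 + vb v y ≤ ‖y‖ := by
      by_contra hlt
      exact hyN (Or.inr ⟨h0, not_le.1 hlt⟩)
    have hge : ‖y‖ ≤ 1 + vb v y := by
      by_contra hlt
      have hc : ContinuousAt (fun y => 1 + vb v y) y := (vb_contAt v L hL y h0).const_add 1
      have hev := hc.eventually_lt continuous_norm.continuousAt (not_le.1 hlt)
      have hev2 := hev.and (isOpen_ne.mem_nhds h0)
      obtain ⟨z, hz, hzN⟩ := mem_closure_iff_nhds.1 hyc _ hev2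
      rcases hzN with h | h
      · exact hz.2 h
      · exact absurd h.2 (not_lt.2 hz.1.le)
    refine ⟨‖y‖⁻¹ • y, dir_mem y h0, ?_⟩
    have hp := norm_pos_iff.2 h0
    rw [FF, vb_homog v _ (inv_pos.2 hp), le_antisymm hle hge, smul_smul,
      mul_inv_cancel₀ hp.ne', one_smul]
  · rintro ⟨x, hx, rfl⟩
    have hx1 : ‖x‖ = 1 := by simpa using hx
    have hx0 : x ≠ 0 := by rintro rfl; simp at hx1
    have hb' := abs_le.1 (hb x hx0)
    have hpos : 0 < 1 + vb v x := by linarith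
    have hFn : ∀ t : ℝ, 0 < t → ‖t • FF v x‖ = t * (1 + vb v x) ∧ vb v (t • FF v x) = vb v x := by
      intro t ht
      refine ⟨?_, ?_⟩
      · rw [FF, norm_smul, norm_smul, hx1, Real.norm_of_nonneg ht.le, Real.norm_of_nonneg hpos.le,
          mul_one]
      · rw [FF, vb_homog v t ht, vb_homog v _ hpos]
    have hF0 : FF v x ≠ 0 := smul_ne_zero hpos.ne' hx0
    constructor
    · have ht : Tendsto (fun t : ℝ => t • FF v x) (𝓝[<] 1) (𝓝 (FF v x)) := by
        have : ContinuousAt (fun t : ℝ => t • FF v x) 1 := by fun_prop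
        have h := this.tendsto
        simp only [one_smul] at h
        exact h.mono_left nhdsWithin_le_nhds
      refine mem_closure_of_tendsto ht ?_
      have h1 : ∀ᶠ t : ℝ in 𝓝[<] 1, 0 < t := nhdsWithin_le_nhds (Ioi_mem_nhds one_pos)
      filter_upwards [h1, self_mem_nhdsWithin] with t ht0 ht1
      refine Or.inr ⟨smul_ne_zero ht0.ne' hF0, ?_⟩
      rw [(hFn t ht0).1, (hFn t ht0).2]
      have : t < 1 := ht1
      nlinarith
    · rintro (h | h)
      · exact hF0 h
      · have h1 := hFn 1 one_pos
        rw [one_smul, one_mul] at h1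
        have := h.2
        rw [h1.1, h1.2] at this
        exact lt_irrefl _ this

end sph

lemma w1_bounds (n : ℕ) (v : EuclideanSpace ℝ (Fin n) → ℝ) (L : ℝ≥0)
    (hL : LipschitzOnWith L v (sphere 0 1)) (hv : w1inf n v ≤ 1 / 2) :
    ∀ x ∈ sphere (0 : EuclideanSpace ℝ (Fin n)) 1, |v x| ≤ 1 / 2 ∧ ‖gradient (vb v) x‖ ≤ 1 / 2 := by
  have hbdd : BddAbove (range fun x : sphereS n => max |v x.1| ‖tGrad n v x.1‖) := by
    obtain ⟨M, hM⟩ := (isCompact_sphere (0 : EuclideanSpace ℝ (Fin n)) 1).exists_bound_of_continuousOn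
      hL.continuousOn
    refine ⟨max M (2 * L * 2), ?_⟩
    rintro _ ⟨x, rfl⟩
    refine max_le_max (hM x.1 x.2) ?_
    have hx1 : ‖x.1‖ = 1 := by simpa [sphereS] using x.2
    change ‖gradient (vb v) x.1‖ ≤ _
    rw [gradient, LinearIsometryEquiv.norm_map]
    have h := vb_lip v L hL (1 / 2) (by norm_num)
    have h2 : {y : EuclideanSpace ℝ (Fin n) | ((1 / 2 : ℝ≥0) : ℝ) ≤ ‖y‖} ∈ 𝓝 x.1 := by
      have : {y : EuclideanSpace ℝ (Fin n) | (1 / 2 : ℝ) < ‖y‖} ∈ 𝓝 x.1 :=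
        (isOpen_lt continuous_const continuous_norm).mem_nhds (by
          change (1 / 2 : ℝ) < ‖x.1‖
          rw [hx1]; norm_num)
      refine mem_of_superset this fun y hy => ?_
      have hy' : (1 / 2 : ℝ) < ‖y‖ := hy
      change ((1 / 2 : ℝ≥0) : ℝ) ≤ ‖y‖
      push_cast
      exact hy'.le
    have := norm_fderiv_le_of_lipschitzOn ℝ h2 h
    simpa using this
  intro x hx
  have h1 := (le_ciSup hbdd ⟨x, hx⟩).trans hv
  exact ⟨(le_max_left _ _).trans h1, (le_max_right _ _).trans h1⟩

/-- Perimeter of a nearly spherical set: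
`P(E) = ∫_{S^{n-1}} (1+v)^{n-2} √((1+v)² + |D_τ v|²) dH^{n-1}`. -/
theorem stmt4 (n : ℕ) (hn : 2 ≤ n) (v : EuclideanSpace ℝ (Fin n) → ℝ)
    (hLip : memW1inf n v) (hvsmall : w1inf n v ≤ 1 / 2) :
    (μH[(n : ℝ) - 1] (frontier (nsSet n v))).toReal =
      ∫ x in sphereS n,
        (1 + v x) ^ (n - 2) * Real.sqrt ((1 + v x) ^ 2 + ‖tGrad n v x‖ ^ 2)
        ∂μH[(n : ℝ) - 1] := by
  obtain ⟨L, hL⟩ := hLip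
  change LipschitzOnWith L v (sphere 0 1) at hL
  have hb := w1_bounds n v L hL hvsmall
  have hE : finrank ℝ (EuclideanSpace ℝ (Fin n)) = n := by simp
  have hm : (0 : ℝ) ≤ (n : ℝ) - 1 := by
    have : (2 : ℝ) ≤ n := by exact_mod_cast hn
    linarith
  have hfr : frontier (nsSet n v) = FF v '' sphere 0 1 := frontier_eq v L hL fun x hx => (hb x hx).1
  set S := sphere (0 : EuclideanSpace ℝ (Fin n)) 1 with hS
  have hSm : MeasurableSet S := isClosed_sphere.measurableSet
  have hS1 : ∀ x ∈ S, ‖x‖ = 1 := fun x hx => by simpa [hS] using hx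
  set D := {x | DifferentiableAt ℝ (vb v) x} with hD
  have hDm : MeasurableSet D := measurableSet_of_differentiableAt ℝ (vb v)
  have hnull : μH[(n : ℝ) - 1] (S \ D) = 0 := vb_null v L hL n hn hE
  have hvbm := vb_measurable v L hL
  have hgm : Measurable (gradient (vb v)) := by
    unfold gradient
    exact (LinearIsometryEquiv.continuous _).measurable.comp (measurable_fderiv ℝ (vb v))
  have hJ : Measurable fun x => JJ n (1 + vb v x) (gradient (vb v) x) := by
    unfold JJ
    fun_prop
  -- Lipschitz bound for FF on the sphere
  have hFL : LipschitzOnWith (L + 2) (FF v) S := by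
    refine LipschitzOnWith.of_dist_le_mul fun x hx z hz => ?_
    have h1 := hL.dist_le_mul x hx z hz
    have hx2 := abs_le.1 (hb x hx).1
    rw [dist_eq_norm, FF, FF, vb_sphere v x (hS1 x hx), vb_sphere v z (hS1 z hz)]
    have e : (1 + v x) • x - (1 + v z) • z = (1 + v x) • (x - z) + (v x - v z) • z := by module
    rw [e]
    refine (norm_add_le _ _).trans ?_
    rw [norm_smul, norm_smul, hS1 z hz, mul_one, Real.norm_of_nonneg (by linarith),
      ← dist_eq_norm, ← dist_eq_norm]
    push_cast
    have : (0 : ℝ) ≤ dist x z := dist_nonneg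
    nlinarith
  have harea := area (FF v) (fun x => 1 + vb v x) (gradient (vb v)) (S ∩ D) (hSm.inter hDm) n hn hE
    (hFL.continuousOn.mono inter_subset_left)
    ((FF_inj v fun x hx => (hb x hx).1).mono inter_subset_left) hJ (fun x hx => hS1 x hx.1)
    (fun x hx => vb_grad_orth v x hx.2)
    (fun x hx => by
      have := abs_le.1 (hb x hx.1).1
      simp only [vb_sphere v x (hS1 x hx.1)]
      linarith)
    (fun x hx => by
      have := abs_le.1 (hb x hx.1).1
      simp only [vb_sphere v x (hS1 x hx.1)]
      linarith)
    (fun x hx => (hb x hx.1).2) (fun x hx => FF_deriv v x hx.2)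
  have hFnull : μH[(n : ℝ) - 1] (FF v '' (S \ D)) = 0 := by
    have := (hFL.mono (sdiff_subset (t := D))).hausdorffMeasure_image_le hm
    rw [hnull, mul_zero] at this
    exact le_antisymm this bot_le
  have e1 : μH[(n : ℝ) - 1] (FF v '' S) = μH[(n : ℝ) - 1] (FF v '' (S ∩ D)) := by
    apply le_antisymm
    · rw [← inter_union_sdiff S D, image_union]
      refine (measure_union_le _ _).trans ?_
      rw [inter_union_sdiff, hFnull, add_zero]
    · exact measure_mono (image_mono inter_subset_left)
  have hae : (S ∩ D : Set _) =ᵐ[μH[(n : ℝ) - 1]] S := by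
    refine (inter_subset_left.eventuallyLE).antisymm ?_
    rw [ae_le_set, inter_comm, sdiff_inter_self_eq_sdiff]
    exact hnull
  have e2 : ∫ x in sphereS n, (1 + v x) ^ (n - 2) *
      Real.sqrt ((1 + v x) ^ 2 + ‖tGrad n v x‖ ^ 2) ∂μH[(n : ℝ) - 1] =
      ∫ x in S, JJ n (1 + vb v x) (gradient (vb v) x) ∂μH[(n : ℝ) - 1] := by
    refine setIntegral_congr_fun hSm fun x hx => ?_
    simp only [vb_sphere v x (hS1 x hx)]
    rfl
  rw [e2, hfr, e1, harea, integral_eq_lintegral_of_nonneg_ae _ hJ.aestronglyMeasurable,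
    setLIntegral_congr hae]
  refine (ae_restrict_iff' hSm).2 (Eventually.of_forall fun x hx => ?_)
  have h1 := abs_le.1 (hb x hx).1
  refine le_trans ?_ (JJ_lower n (1 + vb v x) _ ?_)
  · change (0 : ℝ) ≤ _
    positivity
  · rw [vb_sphere v x (hS1 x hx)]; linarith
end
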